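/- Assume d ≥ 5. For all n ≥ 2 and 1 ≤ T ≤ n, the compensator ξ_n^*(T) := (1/T) Σ_{j=0}^{T−1} Σ_{ℓ=1}^{⌊n/T⌋−1} E[χ_C(R(Ĩ_{j,ℓ}), R(I_{j,ℓ+1})) | F_{j+ℓT}] satisfies ξ_n^*(T) ≤ 2 ξ_n(T), where ξ_n(T) := Σ_{k=0}^n Σ_{x∈R_k} P_x(H_{R_k}^+ = ∞) · (G⋆G_T)(x − S_k)/T. -/

import Mathlib

open Filter Finset MeasureTheory
open scoped symmDiff ENNReal

namespace SRW

/-- Vertices of `ℤ^d`. -/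
abbrev V (d : ℕ) : Type := Fin d → ℤ

/-- The set of nearest-neighbor steps (the `2d` unit vectors `±e_i`) in `ℤ^d`. -/
def steps (d : ℕ) : Finset (V d) :=
  (Finset.univ : Finset (Fin d × Bool)).image
    (fun p j => if j = p.1 then (if p.2 then 1 else -1) else 0)

/-- Position at time `k` of the walk started at `x` with step sequence `s`. -/
def pos {d : ℕ} (x : V d) (s : ℕ → V d) (k : ℕ) : V d :=
  x + ∑ i ∈ Finset.range k, s i

open Classical in
/-- Probability, for the simple random walk, of an event depending on the
first `n` steps (steps beyond `n` are set to `0`): each of the `(2d)^n`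
admissible step sequences has equal probability. -/
noncomputable def probN (d n : ℕ) (P : (ℕ → V d) → Prop) : ℝ :=
  (((Fintype.piFinset fun _ : Fin n => steps d).filter
      (fun s => P fun i => if h : i < n then s ⟨i, h⟩ else 0)).card : ℝ) / ((2 * d : ℕ) : ℝ) ^ n

/-- Expectation of a functional of the first `n` steps of the walk. -/
noncomputable def expN (d n : ℕ) (f : (ℕ → V d) → ℝ) : ℝ :=
  (∑ s ∈ Fintype.piFinset fun _ : Fin n => steps d,
      f fun i => if h : i < n then s ⟨i, h⟩ else 0) / ((2 * d : ℕ) : ℝ) ^ n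

/-- Escape probability `P_x(H_A^+ = ∞)`: the walk started at `x` never
hits `A` at a positive time (decreasing limit of the finite-horizon events). -/
noncomputable def esc (d : ℕ) (A : Set (V d)) (x : V d) : ℝ :=
  ⨅ n : ℕ, probN d n (fun s => ∀ k, 1 ≤ k → k ≤ n → pos x s k ∉ A)

/-- Newtonian capacity `Cap(A) = Σ_{x∈A} P_x(H_A^+ = ∞)`. -/
noncomputable def cap {d : ℕ} (A : Finset (V d)) : ℝ :=
  ∑ x ∈ A, esc d (↑A) x

/-- Green's function `G(z) = Σ_n P_0(S_n = z)`. -/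
noncomputable def G (d : ℕ) (z : V d) : ℝ :=
  ∑' n : ℕ, probN d n (fun s => pos 0 s n = z)

/-- Truncated Green's function `G_T(z) = Σ_{n≤T} P_0(S_n = z)`. -/
noncomputable def GT (d T : ℕ) (z : V d) : ℝ :=
  ∑ n ∈ Finset.range (T + 1), probN d n (fun s => pos 0 s n = z)

/-- Convolution `(G ⋆ G_T)(x) = Σ_y G(x-y) G_T(y)`. -/
noncomputable def GconvGT (d T : ℕ) (x : V d) : ℝ :=
  ∑' y : V d, G d (x - y) * GT d T y

/-- Euclidean norm on `ℤ^d`. -/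
noncomputable def nrm {d : ℕ} (x : V d) : ℝ :=
  Real.sqrt (∑ i, ((x i : ℝ)) ^ 2)

/-- The range `{S_k : k ∈ I}` of the walk started at `x` over the set of times `I`. -/
noncomputable def rangeOn {d : ℕ} (x : V d) (s : ℕ → V d) (I : Finset ℕ) : Finset (V d) :=
  I.image (pos x s)

/-- Probability that the walk started at `z` hits both `A` and `B` in finite time
(increasing limit of the finite-horizon probabilities). -/
noncomputable def hitBothProb (d : ℕ) (A B : Finset (V d)) (z : V d) : ℝ :=
  ⨆ n : ℕ, probN d n (fun s => (∃ k ≤ n, pos z s k ∈ A) ∧ (∃ k ≤ n, pos z s k ∈ B))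

/-- The discrete cube `Q(x,r) = [x - r/2, x + r/2)^d ∩ ℤ^d`. -/
def cube {d : ℕ} (x : V d) (r : ℝ) : Set (V d) :=
  {y | ∀ i, (x i : ℝ) - r / 2 ≤ (y i : ℝ) ∧ (y i : ℝ) < (x i : ℝ) + r / 2}

/-- The corrector `ξ_n(T)`. -/
noncomputable def xi (d n T : ℕ) (s : ℕ → V d) : ℝ :=
  ∑ k ∈ Finset.range (n + 1), ∑ x ∈ rangeOn 0 s (Finset.Icc 0 k),
    esc d (↑(rangeOn 0 s (Finset.Icc 0 k))) x * (GconvGT d T (x - pos 0 s k) / T)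

/-- The capacity cross-term `χ_C(A,B) = Cap(A) + Cap(B) - Cap(A ∪ B)`. -/
noncomputable def chiC {d : ℕ} (A B : Finset (V d)) : ℝ := cap A + cap B - cap (A ∪ B)

open Classical in
/-- Conditional expectation, given the first `m` steps (equal to those of `s`),
of a functional of the first `n` steps. -/
noncomputable def condExpN (d n m : ℕ) (f : (ℕ → V d) → ℝ) (s : ℕ → V d) : ℝ :=
  expN d n (fun s' => if ∀ i < m, s' i = s i then f s' else 0) * ((2 * d : ℕ) : ℝ) ^ m

/-- The compensator `ξ_n^*(T)`. -/
noncomputable def xiStar (d n T : ℕ) (s : ℕ → V d) : ℝ :=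
  (1 / (T : ℝ)) * ∑ j ∈ Finset.range T, ∑ l ∈ Finset.Icc 1 (n / T - 1),
    condExpN d (n + T) (j + l * T)
      (fun s' => chiC (rangeOn 0 s' (Finset.Icc j (j + l * T)))
        (rangeOn 0 s' (Finset.Icc (j + l * T) (j + (l + 1) * T)))) s

/-- `E[Cap(R_n)]`, the expected capacity of the range up to time `n`. -/
noncomputable def expCapRange (d n : ℕ) : ℝ :=
  expN d n (fun s => cap (rangeOn 0 s (Finset.Icc 0 n)))

/-- The maximal capacity `c_n` of the range of a nearest-neighbor path with `n` steps. -/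
noncomputable def maxPathCap (d n : ℕ) : ℝ :=
  sSup {y : ℝ | ∃ (x : V d) (s : ℕ → V d), (∀ i, s i ∈ steps d) ∧
    y = cap (rangeOn x s (Finset.Icc 0 n))}

/-- `Γ(A,Λ) = Σ_{x∈A} Σ_{y∈Λ} G(y-x) P_y(H_Λ^+ = ∞)`. -/
noncomputable def GamFin (d : ℕ) (A : Finset (V d)) (Λ : Set (V d)) : ℝ :=
  ∑ x ∈ A, ∑' y : Λ, G d ((y : V d) - x) * esc d Λ (y : V d)

/-- `P(Γ(R̃_∞, Λ) > t)`, as the increasing limit of the finite-horizon probabilities. -/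
noncomputable def PGam (d : ℕ) (Λ : Set (V d)) (t : ℝ) : ℝ :=
  ⨆ N : ℕ, probN d N (fun s => t < GamFin d (rangeOn 0 s (Finset.Icc 0 N)) Λ)

/-- `E_x[Γ(R̃_∞, Λ)]`, as the increasing limit of the finite-horizon expectations. -/
noncomputable def EGam (d : ℕ) (x : V d) (Λ : Set (V d)) : ℝ :=
  ⨆ N : ℕ, expN d N (fun s => GamFin d (rangeOn x s (Finset.Icc 0 N)) Λ)

/-- The law of the first `n` steps of two independent simple random walks:
uniform measure on pairs of admissible step sequences of length `n`. -/
noncomputable def pairLevel (d n : ℕ) : Measure ((Fin n → V d) × (Fin n → V d)) :=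
  (((2 * d : ℕ) : ℝ≥0∞) ^ (2 * n))⁻¹ •
    ∑ a ∈ Fintype.piFinset fun _ : Fin n => steps d,
      ∑ b ∈ Fintype.piFinset fun _ : Fin n => steps d, Measure.dirac (a, b)

open Classical in
/-- `Γ(R̃_∞, R_∞) = Σ_{x ∈ R̃_∞} Σ_{y ∈ R_∞} G(y-x) P_y(H_{R_∞}^+ = ∞)` for
two (step sequences of) walks, with values in `ℝ≥0∞`. -/
noncomputable def gammaInf (d : ℕ) (sA sB : ℕ → V d) : ℝ≥0∞ :=
  ∑' x : V d, ∑' y : V d,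
    if x ∈ Set.range (pos (0 : V d) sA) ∧ y ∈ Set.range (pos (0 : V d) sB) then
      ENNReal.ofReal (G d (y - x) * esc d (Set.range (pos (0 : V d) sB)) y)
    else 0

/-- The step sequence that starts with `e` and continues with `t`. -/
def consStep {d : ℕ} (e : V d) (t : ℕ → V d) : ℕ → V d
  | 0 => e
  | i + 1 => t i

/-- The step sequence that follows `s` for `m` steps and then follows `t`. -/
def splice {d : ℕ} (m : ℕ) (s t : ℕ → V d) : ℕ → V d :=
  fun i => if i < m then s i else t (i - m)

/-- The transition operator of the simple random walk. -/
noncomputable def transOp (d : ℕ) : (V d → ℝ) →ₗ[ℝ] (V d → ℝ) where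
  toFun φ z := (∑ e ∈ steps d, φ (z + e)) / ((2 * d : ℕ) : ℝ)
  map_add' φ ψ := by
    ext z
    simp [Finset.sum_add_distrib, add_div]
  map_smul' c φ := by
    ext z
    simp [← Finset.mul_sum, mul_div_assoc]

lemma transOp_apply {d : ℕ} (φ : V d → ℝ) (z : V d) :
    transOp d φ z = (∑ e ∈ steps d, φ (z + e)) / ((2 * d : ℕ) : ℝ) := rfl

lemma card_steps (d : ℕ) : (steps d).card = 2 * d := by
  rw [steps, Finset.card_image_of_injective]
  · simp [mul_comm]
  · rintro ⟨i, b⟩ ⟨j, c⟩ h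
    have hi := congrFun h i
    by_cases hij : i = j
    · subst hij
      cases b <;> cases c <;> simp_all
    · cases b <;> simp [hij] at hi

lemma neg_mem_steps {d : ℕ} {e : V d} (he : e ∈ steps d) : -e ∈ steps d := by
  simp only [steps, Finset.mem_image, Finset.mem_univ, true_and] at he ⊢
  obtain ⟨⟨i, b⟩, rfl⟩ := he
  refine ⟨⟨i, !b⟩, ?_⟩
  ext j
  cases b <;> by_cases h : j = i <;> simp [h]

lemma pos_consStep_succ {d : ℕ} (x e : V d) (t : ℕ → V d) (k : ℕ) :
    pos x (consStep e t) (k + 1) = pos (x + e) t k := by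
  simp [pos, Finset.sum_range_succ', consStep, add_comm, add_left_comm]

lemma pos_zero {d : ℕ} (x : V d) (t : ℕ → V d) : pos x t 0 = x := by simp [pos]

lemma pos_eq_add {d : ℕ} (x : V d) (t : ℕ → V d) (k : ℕ) : pos x t k = x + pos 0 t k := by
  simp [pos]

lemma pos_splice_of_le {d : ℕ} (x : V d) (s t : ℕ → V d) {k m : ℕ} (h : k ≤ m) :
    pos x (splice m s t) k = pos x s k := by
  unfold pos
  congr 1
  refine Finset.sum_congr rfl fun i hi => ?_
  have := Finset.mem_range.1 hi
  simp [splice, show i < m by omega]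

lemma pos_splice_add {d : ℕ} (x : V d) (s t : ℕ → V d) (m k : ℕ) :
    pos x (splice m s t) (m + k) = pos (pos x s m) t k := by
  have h := pos_splice_of_le x s t (le_refl m)
  unfold pos at h ⊢
  rw [Finset.sum_range_add, ← add_assoc, h]
  congr 1
  exact Finset.sum_congr rfl fun i _ => by simp [splice]

lemma expN_zero (d : ℕ) (f : (ℕ → V d) → ℝ) : expN d 0 f = f 0 := by
  simp [expN]
  rfl

lemma extend_cons {d n : ℕ} (e : V d) (t : Fin n → V d) :
    (fun i => if h : i < n + 1 then (Fin.cons e t : Fin (n + 1) → V d) ⟨i, h⟩ else 0) =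
      consStep e (fun i => if h : i < n then t ⟨i, h⟩ else 0) := by
  funext i
  cases i with
  | zero => rfl
  | succ i =>
    by_cases h : i < n
    · simp only [consStep, h, Nat.succ_lt_succ_iff, dif_pos]
      rfl
    · simp [consStep, h]

lemma expN_succ (d n : ℕ) (f : (ℕ → V d) → ℝ) :
    expN d (n + 1) f =
      (∑ e ∈ steps d, expN d n fun t => f (consStep e t)) / ((2 * d : ℕ) : ℝ) := by
  simp only [expN]
  rw [← Finset.sum_div, div_div, ← pow_succ]
  congr 1
  rw [← Finset.sum_product']
  refine Finset.sum_bij' (fun s _ => (s 0, Fin.tail s)) (fun p _ => Fin.cons p.1 p.2)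
    ?_ ?_ ?_ ?_ ?_
  · intro s hs
    rw [Fintype.mem_piFinset] at hs
    exact Finset.mem_product.2 ⟨hs 0, Fintype.mem_piFinset.2 fun i => hs i.succ⟩
  · rintro ⟨e, t⟩ h
    rw [Finset.mem_product, Fintype.mem_piFinset] at h
    rw [Fintype.mem_piFinset]
    intro i
    refine Fin.cases ?_ (fun i => ?_) i
    · exact h.1
    · exact h.2 i
  · intro s _
    exact Fin.cons_self_tail s
  · rintro ⟨e, t⟩ _
    simp
  · intro s _
    rw [← extend_cons, Fin.cons_self_tail]

lemma expN_mono {d : ℕ} (n : ℕ) {f g : (ℕ → V d) → ℝ} (h : ∀ t, f t ≤ g t) :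
    expN d n f ≤ expN d n g :=
  div_le_div_of_nonneg_right (Finset.sum_le_sum fun _ _ => h _) (by positivity)

lemma expN_const_mul {d : ℕ} (n : ℕ) (c : ℝ) (f : (ℕ → V d) → ℝ) :
    expN d n (fun t => c * f t) = c * expN d n f := by
  simp [expN, ← Finset.mul_sum, mul_div_assoc]

lemma expN_sum {d : ℕ} {ι : Type*} (n : ℕ) (I : Finset ι) (f : ι → (ℕ → V d) → ℝ) :
    expN d n (fun t => ∑ i ∈ I, f i t) = ∑ i ∈ I, expN d n (f i) := by
  simp only [expN]
  rw [Finset.sum_comm, Finset.sum_div]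

lemma expN_const_zero (d n : ℕ) : expN d n (fun _ => 0) = 0 := by simp [expN]

open Classical in
lemma probN_eq_expN (d n : ℕ) (Q : (ℕ → V d) → Prop) :
    probN d n Q = expN d n fun t => if Q t then 1 else 0 := by
  simp [probN, expN]

lemma expN_pos {d : ℕ} (hd : d ≠ 0) (φ : V d → ℝ) {n k : ℕ} (hk : k ≤ n) (z : V d) :
    expN d n (fun t => φ (pos z t k)) = (transOp d ^ k) φ z := by
  have hd' : ((2 * d : ℕ) : ℝ) ≠ 0 := by positivity
  induction n generalizing k z with
  | zero =>
    obtain rfl : k = 0 := by omega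
    simp [expN_zero, pos_zero]
  | succ n ih =>
    rw [expN_succ]
    cases k with
    | zero =>
      have h0 : ∀ e ∈ steps d, (expN d n fun t => φ (pos z (consStep e t) 0)) = φ z := by
        intro e _
        simpa [pos_zero] using ih (Nat.zero_le n) z
      rw [Finset.sum_congr rfl h0, Finset.sum_const, card_steps, nsmul_eq_mul,
        mul_div_cancel_left₀ _ hd']
      simp
    | succ k =>
      rw [pow_succ', Module.End.mul_apply, transOp_apply]
      congr 1
      refine Finset.sum_congr rfl fun e _ => ?_
      simp only [pos_consStep_succ]
      exact ih (by omega) _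

lemma condExpN_eq_expN_splice {d : ℕ} (hd : d ≠ 0) (n m : ℕ) (f : (ℕ → V d) → ℝ) (s : ℕ → V d)
    (hs : ∀ i, s i ∈ steps d) :
    condExpN d (m + n) m f s = expN d n fun t => f (splice m s t) := by
  have hd' : ((2 * d : ℕ) : ℝ) ≠ 0 := by positivity
  induction m generalizing f s with
  | zero =>
    have h0 : ∀ t : ℕ → V d, splice 0 s t = t := fun t => by
      funext i
      simp [splice]
    simp [condExpN, h0]
  | succ m ih =>
    have key := ih (fun t => f (consStep (s 0) t)) (fun i => s (i + 1)) fun i => hs _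
    have hsp : ∀ t : ℕ → V d,
        consStep (s 0) (splice m (fun i => s (i + 1)) t) = splice (m + 1) s t := by
      intro t
      funext i
      cases i <;> simp [consStep, splice]
    simp only [hsp] at key
    rw [← key]
    simp only [condExpN]
    rw [show m + 1 + n = (m + n) + 1 by omega, expN_succ, Finset.sum_eq_single (s 0)]
    · rw [pow_succ, div_mul_eq_mul_div, ← mul_assoc, mul_div_cancel_right₀ _ hd']
      congr 2
      funext t
      congr 1
      rw [Nat.forall_lt_succ_left]
      simp [consStep]
    · intro e _ he
      have hne : ∀ t, ¬ ∀ i < m + 1, consStep e t i = s i := fun t h => he (h 0 (Nat.succ_pos m))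
      simp only [hne, if_false, expN_const_zero]
    · exact fun h => (h (hs 0)).elim

lemma transOp_mono {d : ℕ} {φ ψ : V d → ℝ} (h : ∀ z, φ z ≤ ψ z) (z : V d) :
    transOp d φ z ≤ transOp d ψ z :=
  div_le_div_of_nonneg_right (Finset.sum_le_sum fun _ _ => h _) (by positivity)

lemma transOp_pow_mono {d : ℕ} {φ ψ : V d → ℝ} (h : ∀ z, φ z ≤ ψ z) (k : ℕ) (z : V d) :
    (transOp d ^ k) φ z ≤ (transOp d ^ k) ψ z := by
  induction k generalizing z with
  | zero => simpa using h z
  | succ k ih =>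
    simp only [pow_succ', Module.End.mul_apply]
    exact transOp_mono ih z

lemma transOp_one {d : ℕ} (hd : d ≠ 0) : transOp d 1 = 1 := by
  have hd' : ((2 * d : ℕ) : ℝ) ≠ 0 := by positivity
  ext z
  simp only [transOp_apply, Pi.one_apply, Finset.sum_const, card_steps, nsmul_eq_mul, mul_one]
  exact div_self hd'

lemma transOp_comp_neg {d : ℕ} (φ : V d → ℝ) :
    transOp d (fun z => φ (-z)) = fun z => transOp d φ (-z) := by
  ext z
  simp only [transOp_apply]
  congr 1
  refine Finset.sum_nbij' (fun e => -e) (fun e => -e) (fun e he => neg_mem_steps he)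
    (fun e he => neg_mem_steps he) ?_ ?_ ?_ <;> intros <;> simp [add_comm]

lemma transOp_pow_comp_neg {d : ℕ} (φ : V d → ℝ) (k : ℕ) :
    (transOp d ^ k) (fun z => φ (-z)) = fun z => (transOp d ^ k) φ (-z) := by
  induction k with
  | zero => simp
  | succ k ih =>
    simp only [pow_succ', Module.End.mul_apply, ih]
    exact transOp_comp_neg _

/-- The `k`-step transition probability from `0` to `z`. -/
noncomputable def heat (d k : ℕ) (z : V d) : ℝ := probN d k fun s => pos 0 s k = z

lemma heat_nonneg (d k : ℕ) (z : V d) : 0 ≤ heat d k z := by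
  unfold heat probN
  positivity

lemma transOp_pow_single {d : ℕ} (hd : d ≠ 0) (k : ℕ) (w z : V d) :
    (transOp d ^ k) (Pi.single w 1) z = heat d k (w - z) := by
  rw [heat, probN_eq_expN, ← expN_pos hd _ le_rfl]
  congr 1
  funext t
  rw [Pi.single_apply, pos_eq_add z]
  simp [eq_sub_iff_add_eq, add_comm]

lemma heat_neg {d : ℕ} (hd : d ≠ 0) (k : ℕ) (z : V d) : heat d k (-z) = heat d k z := by
  have h := congrFun (transOp_pow_comp_neg (Pi.single z (1 : ℝ)) k) 0
  have h2 : (fun y : V d => (Pi.single z (1 : ℝ) : V d → ℝ) (-y)) = Pi.single (-z) 1 := by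
    funext y
    simp [Pi.single_apply, neg_eq_iff_eq_neg]
  rw [h2] at h
  simpa [transOp_pow_single hd] using h

lemma G_eq_tsum_heat (d : ℕ) (z : V d) : G d z = ∑' k, heat d k z := rfl

lemma G_neg {d : ℕ} (hd : d ≠ 0) (z : V d) : G d (-z) = G d z := by
  simp only [G_eq_tsum_heat, heat_neg hd]

lemma G_nonneg (d : ℕ) (z : V d) : 0 ≤ G d z := tsum_nonneg fun k => heat_nonneg d k z

lemma hasSum_heat_mul {d : ℕ} (hd : d ≠ 0) (k : ℕ) (φ : V d → ℝ) (z : V d) :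
    HasSum (fun y => heat d k (y - z) * φ y) ((transOp d ^ k) φ z) := by
  simp only [← transOp_pow_single hd]
  induction k generalizing z with
  | zero =>
    convert hasSum_single z ?_ using 1
    · simp
    · intro y hy
      simp [hy.symm]
  | succ k ih =>
    simp only [pow_succ', Module.End.mul_apply, transOp_apply]
    simp only [div_mul_eq_mul_div, Finset.sum_mul]
    exact (hasSum_sum (s := steps d) fun e _ => ih (z + e)).div_const _

lemma GconvGT_eq {d : ℕ} (hd : d ≠ 0) (T : ℕ) (x : V d) :
    GconvGT d T x = ∑ k ∈ Finset.range (T + 1), (transOp d ^ k) (fun y => G d (x - y)) 0 := by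
  have h := hasSum_sum (s := Finset.range (T + 1)) fun k _ =>
    hasSum_heat_mul hd k (fun y => G d (x - y)) 0
  rw [← h.tsum_eq, GconvGT]
  congr 1
  funext y
  simp only [GT, sub_zero, Finset.mul_sum]
  exact Finset.sum_congr rfl fun k _ => mul_comm _ _

lemma GconvGT_nonneg (d T : ℕ) (x : V d) : 0 ≤ GconvGT d T x :=
  tsum_nonneg fun y => mul_nonneg (G_nonneg _ _) (Finset.sum_nonneg fun k _ => heat_nonneg d k y)

/-- The probability that the walk from `x` avoids `A` at the times `1, …, N`. -/
noncomputable def escN (d N : ℕ) (A : Set (V d)) (x : V d) : ℝ :=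
  probN d N fun s => ∀ k, 1 ≤ k → k ≤ N → pos x s k ∉ A

lemma escN_nonneg (d N : ℕ) (A : Set (V d)) (x : V d) : 0 ≤ escN d N A x := by
  unfold escN probN
  positivity

lemma escN_zero (d : ℕ) (A : Set (V d)) : escN d 0 A = 1 := by
  ext x
  rw [escN, probN_eq_expN, expN_zero, if_pos]
  · rfl
  · intro k h1 h2
    omega

lemma escN_succ (d N : ℕ) (A : Set (V d)) :
    escN d (N + 1) A = transOp d (Aᶜ.indicator (escN d N A)) := by
  classical
  ext x
  rw [transOp_apply, escN, probN_eq_expN, expN_succ]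
  congr 1
  refine Finset.sum_congr rfl fun e _ => ?_
  have hiff : ∀ t : ℕ → V d, (∀ k, 1 ≤ k → k ≤ N + 1 → pos x (consStep e t) k ∉ A) ↔
      x + e ∉ A ∧ ∀ k, 1 ≤ k → k ≤ N → pos (x + e) t k ∉ A := by
    intro t
    constructor
    · intro h
      refine ⟨?_, fun k _ hk => ?_⟩
      · simpa [pos_consStep_succ, pos_zero] using h 1 le_rfl (by omega)
      · simpa [pos_consStep_succ] using h (k + 1) (by omega) (by omega)
    · rintro ⟨h0, h⟩ k hk hk'
      obtain ⟨k, rfl⟩ := Nat.exists_eq_add_of_le' hk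
      rw [pos_consStep_succ]
      rcases Nat.eq_zero_or_pos k with rfl | hk0
      · rwa [pos_zero]
      · exact h k hk0 (by omega)
  by_cases hA : x + e ∈ A
  · simp only [hiff, hA, not_true_eq_false, false_and, if_false, Set.mem_compl_iff,
      Set.indicator_of_notMem, not_false_eq_true, expN_const_zero]
  · rw [Set.indicator_of_mem (by simpa using hA), escN, probN_eq_expN]
    congr 1
    funext t
    congr 1
    simp [hiff, hA]

lemma escN_antitone {d : ℕ} (hd : d ≠ 0) (A : Set (V d)) (x : V d) :
    Antitone fun N => escN d N A x := by
  have key : ∀ N x, escN d (N + 1) A x ≤ escN d N A x := by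
    intro N
    induction N with
    | zero =>
      intro x
      rw [escN_succ, escN_zero]
      have hle : ∀ z, Aᶜ.indicator (1 : V d → ℝ) z ≤ (1 : V d → ℝ) z := fun z =>
        Set.indicator_le_self' (fun _ _ => zero_le_one) z
      have hmono := transOp_mono hle x
      rwa [transOp_one hd] at hmono
    | succ N ih =>
      intro x
      have hle : ∀ z, Aᶜ.indicator (escN d (N + 1) A) z ≤ Aᶜ.indicator (escN d N A) z :=
        fun z => Set.indicator_le_indicator (ih z)
      have hmono := transOp_mono hle x
      rwa [← escN_succ, ← escN_succ] at hmono
  exact antitone_nat_of_succ_le fun N => key N x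

lemma bddBelow_escN (d : ℕ) (A : Set (V d)) (x : V d) :
    BddBelow (Set.range fun N => escN d N A x) :=
  ⟨0, by rintro _ ⟨N, rfl⟩; exact escN_nonneg d N A x⟩

lemma tendsto_escN {d : ℕ} (hd : d ≠ 0) (A : Set (V d)) (x : V d) :
    Tendsto (fun N => escN d N A x) atTop (nhds (esc d A x)) :=
  tendsto_atTop_ciInf (escN_antitone hd A x) (bddBelow_escN d A x)

lemma esc_le_escN (d N : ℕ) (A : Set (V d)) (x : V d) : esc d A x ≤ escN d N A x :=
  ciInf_le (bddBelow_escN d A x) N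

lemma esc_nonneg (d : ℕ) (A : Set (V d)) (x : V d) : 0 ≤ esc d A x :=
  le_ciInf fun N => escN_nonneg d N A x

lemma escN_le_one {d : ℕ} (hd : d ≠ 0) (N : ℕ) (A : Set (V d)) (x : V d) : escN d N A x ≤ 1 :=
  (escN_antitone hd A x (Nat.zero_le N)).trans_eq (by simp [escN_zero])

lemma esc_le_one {d : ℕ} (hd : d ≠ 0) (A : Set (V d)) (x : V d) : esc d A x ≤ 1 :=
  (esc_le_escN d 0 A x).trans (escN_le_one hd 0 A x)

lemma esc_anti {d : ℕ} {A B : Set (V d)} (h : A ⊆ B) (x : V d) : esc d B x ≤ esc d A x := by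
  refine ciInf_mono (bddBelow_escN d B x) fun N => ?_
  classical
  simp only [probN_eq_expN]
  refine expN_mono N fun t => ?_
  split_ifs with h1 h2 h2
  · exact le_rfl
  · exact (h2 fun k hk hk' hA => h1 k hk hk' (h hA)).elim
  · exact zero_le_one
  · exact le_rfl

/-- Last-exit decomposition up to time `N`. -/
lemma sum_transOp_pow_add_escN {d : ℕ} (hd : d ≠ 0) (A : Set (V d)) (N : ℕ) :
    ∑ k ∈ Finset.range (N + 1), (transOp d ^ k) (A.indicator (escN d (N - k) A)) +
      Aᶜ.indicator (escN d N A) = 1 := by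
  induction N with
  | zero =>
    simp [Set.indicator_self_add_compl, escN_zero]
  | succ N ih =>
    rw [Finset.sum_range_succ']
    have hterm : ∀ k ∈ Finset.range (N + 1),
        (transOp d ^ (k + 1)) (A.indicator (escN d (N + 1 - (k + 1)) A)) =
          transOp d ((transOp d ^ k) (A.indicator (escN d (N - k) A))) := by
      intro k _
      rw [pow_succ', Module.End.mul_apply, Nat.add_sub_add_right]
    rw [Finset.sum_congr rfl hterm, ← map_sum, eq_sub_of_add_eq ih, map_sub, transOp_one hd,
      ← escN_succ, add_assoc, pow_zero, Module.End.one_apply, Nat.sub_zero,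
      Set.indicator_self_add_compl]
    simp

/-- Last-exit decomposition up to time `N`, in terms of transition probabilities. -/
lemma sum_heat_mul_escN {d : ℕ} (hd : d ≠ 0) (A : Finset (V d)) (N : ℕ) (z : V d) :
    ∑ x ∈ A, ∑ k ∈ Finset.range (N + 1), heat d k (x - z) * escN d (N - k) A x =
      1 - (A : Set (V d))ᶜ.indicator (escN d N A) z := by
  have h := congrFun (sum_transOp_pow_add_escN hd (A : Set (V d)) N) z
  rw [Pi.add_apply, Pi.one_apply, Finset.sum_apply] at h
  rw [← h, add_sub_cancel_right, Finset.sum_comm]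
  refine Finset.sum_congr rfl fun k _ => ?_
  have hind : (A : Set (V d)).indicator (escN d (N - k) A) =
      ∑ x ∈ A, escN d (N - k) A x • (Pi.single x 1 : V d → ℝ) := by
    funext y
    simp [Finset.sum_apply, Pi.single_apply, Set.indicator_apply]
  rw [hind, map_sum, Finset.sum_apply]
  refine Finset.sum_congr rfl fun x _ => ?_
  rw [map_smul, Pi.smul_apply, transOp_pow_single hd, smul_eq_mul, mul_comm]

lemma esc_eq_zero_of_not_summable {d : ℕ} (hd : d ≠ 0) (h : ¬ Summable fun k => heat d k 0)
    {A : Finset (V d)} {x : V d} (hx : x ∈ A) : esc d A x = 0 := by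
  by_contra hne
  have hpos : 0 < esc d A x := lt_of_le_of_ne (esc_nonneg _ _ _) (Ne.symm hne)
  refine h (summable_of_sum_range_le (c := 1 / esc d A x) (fun k => heat_nonneg d k 0) fun N => ?_)
  rw [le_div_iff₀ hpos]
  have hle : ∑ x' ∈ A, ∑ k ∈ Finset.range (N + 1), heat d k (x' - x) * escN d (N - k) A x' ≤ 1 := by
    rw [sum_heat_mul_escN hd]
    simp [hx]
  calc (∑ k ∈ Finset.range N, heat d k 0) * esc d A x
      ≤ (∑ k ∈ Finset.range (N + 1), heat d k 0) * esc d A x := by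
        refine mul_le_mul_of_nonneg_right ?_ hpos.le
        rw [Finset.sum_range_succ]
        exact le_add_of_nonneg_right (heat_nonneg _ _ _)
    _ ≤ ∑ k ∈ Finset.range (N + 1), heat d k (x - x) * escN d (N - k) A x := by
        rw [Finset.sum_mul, sub_self]
        exact Finset.sum_le_sum fun k _ =>
          mul_le_mul_of_nonneg_left (esc_le_escN _ _ _ _) (heat_nonneg _ _ _)
    _ ≤ _ := Finset.single_le_sum (f := fun x' => ∑ k ∈ Finset.range (N + 1),
          heat d k (x' - x) * escN d (N - k) A x') (fun x' _ => Finset.sum_nonneg fun k _ =>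
          mul_nonneg (heat_nonneg _ _ _) (escN_nonneg _ _ _ _)) hx
    _ ≤ 1 := hle

lemma sum_heat_le_sum_heat_zero {d : ℕ} (hd : d ≠ 0) (N : ℕ) (z : V d) :
    ∑ k ∈ Finset.range N, heat d k z ≤ ∑ k ∈ Finset.range N, heat d k 0 := by
  have hsucc : ∀ k (y : V d), heat d (k + 1) y = transOp d (heat d k) y := by
    intro k y
    have h := transOp_pow_single hd (k + 1) 0 y
    rw [zero_sub, heat_neg hd, pow_succ', Module.End.mul_apply] at h
    have hk : (transOp d ^ k) (Pi.single 0 1) = heat d k := by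
      funext w
      rw [transOp_pow_single hd, zero_sub, heat_neg hd]
    rw [← h, hk]
  induction N generalizing z with
  | zero => simp
  | succ N ih =>
    by_cases hz : z = 0
    · rw [hz]
    · have h0 : heat d 0 z = 0 := by
        have := transOp_pow_single hd 0 z 0
        rw [sub_zero] at this
        rw [← this]
        simp [Ne.symm hz]
      rw [Finset.sum_range_succ', h0, add_zero]
      calc ∑ k ∈ Finset.range N, heat d (k + 1) z
          = transOp d (∑ k ∈ Finset.range N, heat d k) z := by
            rw [map_sum, Finset.sum_apply]
            exact Finset.sum_congr rfl fun k _ => hsucc k z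
        _ ≤ transOp d ((∑ k ∈ Finset.range N, heat d k 0) • (1 : V d → ℝ)) z := by
            refine transOp_mono (fun y => ?_) z
            rw [Finset.sum_apply]
            simpa using ih y
        _ = ∑ k ∈ Finset.range N, heat d k 0 := by
            rw [map_smul, transOp_one hd]
            simp
        _ ≤ _ := by
            rw [Finset.sum_range_succ]
            exact le_add_of_nonneg_right (heat_nonneg _ _ _)

lemma summable_heat {d : ℕ} (hd : d ≠ 0) (h : Summable fun k => heat d k 0) (z : V d) :
    Summable fun k => heat d k z :=
  summable_of_sum_range_le (fun k => heat_nonneg d k z) fun N =>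
    (sum_heat_le_sum_heat_zero hd N z).trans
      (h.sum_le_tsum _ fun k _ => heat_nonneg d k 0)

/-- The equilibrium potential `G e_A` of `A`. -/
noncomputable def eqPot {d : ℕ} (A : Finset (V d)) (z : V d) : ℝ :=
  ∑ x ∈ A, G d (x - z) * esc d A x

lemma eqPot_nonneg {d : ℕ} (A : Finset (V d)) (z : V d) : 0 ≤ eqPot A z :=
  Finset.sum_nonneg fun _ _ => mul_nonneg (G_nonneg _ _) (esc_nonneg _ _ _)

/-- Last-exit decomposition. -/
lemma eqPot_eq {d : ℕ} (hd : d ≠ 0) (h : Summable fun k => heat d k 0) (A : Finset (V d))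
    (z : V d) : eqPot A z = 1 - (A : Set (V d))ᶜ.indicator (esc d A) z := by
  have hlim : Tendsto (fun N => ∑ x ∈ A, ∑ k ∈ Finset.range (N + 1),
      heat d k (x - z) * escN d (N - k) A x) atTop (nhds (eqPot A z)) := by
    refine tendsto_finsetSum _ fun x _ => ?_
    have hdom := tendsto_tsum_of_dominated_convergence
      (f := fun N k => if k ∈ Finset.range (N + 1) then
        heat d k (x - z) * escN d (N - k) A x else 0)
      (g := fun k => heat d k (x - z) * esc d A x) (𝓕 := atTop)
      (summable_heat hd h (x - z)) ?_ ?_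
    · rw [tsum_mul_right] at hdom
      refine hdom.congr fun N => ?_
      rw [tsum_eq_sum (s := Finset.range (N + 1)) fun k hk => if_neg hk]
      exact Finset.sum_congr rfl fun k hk => if_pos hk
    · intro k
      have ht : Tendsto (fun N => heat d k (x - z) * escN d (N - k) A x) atTop
          (nhds (heat d k (x - z) * esc d A x)) :=
        ((tendsto_escN hd _ x).comp (tendsto_sub_atTop_nat k)).const_mul _
      refine ht.congr' ?_
      filter_upwards [eventually_ge_atTop k] with N hN
      rw [if_pos (Finset.mem_range.2 (by omega))]
    · refine Eventually.of_forall fun N k => ?_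
      have h1 := heat_nonneg d k (x - z)
      split_ifs
      · rw [Real.norm_of_nonneg (mul_nonneg h1 (escN_nonneg _ _ _ _))]
        exact mul_le_of_le_one_right h1 (escN_le_one hd _ _ _)
      · simpa using h1
  have hlim2 : Tendsto (fun N => 1 - (A : Set (V d))ᶜ.indicator (escN d N A) z) atTop
      (nhds (1 - (A : Set (V d))ᶜ.indicator (esc d A) z)) := by
    refine Tendsto.const_sub 1 ?_
    by_cases hz : z ∈ (A : Set (V d))ᶜ
    · simpa only [Set.indicator_of_mem hz] using tendsto_escN hd _ z
    · simp only [Set.indicator_of_notMem hz, tendsto_const_nhds]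
  simp only [sum_heat_mul_escN hd] at hlim
  exact tendsto_nhds_unique hlim hlim2

lemma eqPot_eq_one {d : ℕ} (hd : d ≠ 0) (h : Summable fun k => heat d k 0) {A : Finset (V d)}
    {z : V d} (hz : z ∈ A) : eqPot A z = 1 := by
  simp [eqPot_eq hd h, hz]

lemma eqPot_mono {d : ℕ} (hd : d ≠ 0) (h : Summable fun k => heat d k 0) {A B : Finset (V d)}
    (hAB : A ⊆ B) (z : V d) : eqPot A z ≤ eqPot B z := by
  rw [eqPot_eq hd h, eqPot_eq hd h]
  refine sub_le_sub_left ?_ 1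
  have hAB' : (A : Set (V d)) ⊆ B := Finset.coe_subset.2 hAB
  refine (Set.indicator_le_indicator (esc_anti hAB' z)).trans ?_
  exact Set.indicator_le_indicator_of_subset (Set.compl_subset_compl.2 hAB')
    (fun y => esc_nonneg _ _ _) z

lemma cap_eq_sum_eqPot {d : ℕ} (hd : d ≠ 0) (h : Summable fun k => heat d k 0)
    {A U : Finset (V d)} (hAU : A ⊆ U) : cap A = ∑ z ∈ U, esc d U z * eqPot A z := by
  calc cap A = ∑ x ∈ A, esc d A x * eqPot U x :=
        Finset.sum_congr rfl fun x hx => by rw [eqPot_eq_one hd h (hAU hx), mul_one]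
    _ = _ := by
        simp only [eqPot, Finset.mul_sum]
        rw [Finset.sum_comm]
        refine Finset.sum_congr rfl fun z _ => Finset.sum_congr rfl fun x _ => ?_
        rw [← G_neg hd (z - x), neg_sub]
        ring

lemma chiC_le {d : ℕ} (hd : d ≠ 0) (h : Summable fun k => heat d k 0) (A B : Finset (V d)) :
    chiC A B ≤ 2 * ∑ y ∈ B, eqPot A y := by
  have hA : A ⊆ A ∪ B := Finset.subset_union_left
  have hB : B ⊆ A ∪ B := Finset.subset_union_right
  set U := A ∪ B with hU
  have hchi : chiC A B = ∑ z ∈ U, esc d U z * (eqPot A z + eqPot B z - 1) := by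
    rw [chiC, cap_eq_sum_eqPot hd h hA, cap_eq_sum_eqPot hd h hB, cap, ← hU,
      ← Finset.sum_add_distrib, ← Finset.sum_sub_distrib]
    exact Finset.sum_congr rfl fun z _ => by ring
  have hterm : ∀ z ∈ U, esc d U z * (eqPot A z + eqPot B z - 1) ≤
      (if z ∈ A then esc d A z * eqPot B z else 0) + (if z ∈ B then eqPot A z else 0) := by
    intro z hz
    have e0 := esc_nonneg d U z
    have e1 := esc_le_one hd (U : Set (V d)) z
    have a0 := eqPot_nonneg A z
    have b0 := eqPot_nonneg B z
    have eA : esc d U z ≤ esc d A z := esc_anti (Finset.coe_subset.2 hA) z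
    by_cases hzA : z ∈ A
    · have hm : esc d U z * eqPot B z ≤ esc d A z * eqPot B z := mul_le_mul_of_nonneg_right eA b0
      rw [if_pos hzA, eqPot_eq_one hd h hzA]
      split_ifs <;> linarith
    · have hzB : z ∈ B := (Finset.mem_union.1 hz).resolve_left hzA
      have hm : esc d U z * eqPot A z ≤ eqPot A z := mul_le_of_le_one_left a0 e1
      rw [if_neg hzA, if_pos hzB, eqPot_eq_one hd h hzB]
      linarith
  have hswap : ∑ z ∈ A, esc d A z * eqPot B z ≤ ∑ y ∈ B, eqPot A y := by
    simp only [eqPot, Finset.mul_sum]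
    rw [Finset.sum_comm]
    refine Finset.sum_le_sum fun y _ => Finset.sum_le_sum fun x _ => ?_
    rw [← G_neg hd (y - x), neg_sub, mul_comm]
    exact mul_le_mul_of_nonneg_right
      (mul_le_of_le_one_right (G_nonneg _ _) (esc_le_one hd _ _)) (esc_nonneg _ _ _)
  calc chiC A B ≤ ∑ z ∈ U, ((if z ∈ A then esc d A z * eqPot B z else 0) +
        (if z ∈ B then eqPot A z else 0)) := by
        rw [hchi]
        exact Finset.sum_le_sum hterm
    _ = ∑ z ∈ A, esc d A z * eqPot B z + ∑ y ∈ B, eqPot A y := by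
        rw [Finset.sum_add_distrib, Finset.sum_ite_mem, Finset.sum_ite_mem,
          Finset.inter_eq_right.2 hA, Finset.inter_eq_right.2 hB]
    _ ≤ _ := by linarith

lemma sum_esc_mul_GconvGT {d : ℕ} (hd : d ≠ 0) (T : ℕ) (A : Finset (V d)) (z : V d) :
    ∑ x ∈ A, esc d A x * GconvGT d T (x - z) =
      ∑ k ∈ Finset.range (T + 1), (transOp d ^ k) (fun y => eqPot A (z + y)) 0 := by
  simp only [GconvGT_eq hd, Finset.mul_sum]
  rw [Finset.sum_comm]
  refine Finset.sum_congr rfl fun k _ => ?_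
  have hpot : (fun y => eqPot A (z + y)) =
      ∑ x ∈ A, esc d A x • fun y => G d (x - z - y) := by
    funext y
    simp only [eqPot, Finset.sum_apply, Pi.smul_apply, smul_eq_mul, sub_sub]
    exact Finset.sum_congr rfl fun x _ => mul_comm _ _
  rw [hpot, map_sum, Finset.sum_apply]
  exact Finset.sum_congr rfl fun x _ => by rw [map_smul, Pi.smul_apply, smul_eq_mul]

lemma sum_esc_mul_GconvGT_mono {d : ℕ} (hd : d ≠ 0) (h : Summable fun k => heat d k 0) (T : ℕ)
    {A B : Finset (V d)} (hAB : A ⊆ B) (z : V d) :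
    ∑ x ∈ A, esc d A x * GconvGT d T (x - z) ≤ ∑ x ∈ B, esc d B x * GconvGT d T (x - z) := by
  simp only [sum_esc_mul_GconvGT hd]
  exact Finset.sum_le_sum fun k _ => transOp_pow_mono (fun y => eqPot_mono hd h hAB _) k 0

lemma rangeOn_splice_Icc {d : ℕ} (s t : ℕ → V d) (j m : ℕ) :
    rangeOn 0 (splice m s t) (Finset.Icc j m) = rangeOn 0 s (Finset.Icc j m) :=
  Finset.image_congr fun _ hk => pos_splice_of_le _ _ _ (Finset.mem_Icc.1 hk).2

lemma rangeOn_splice_Icc_add {d : ℕ} (s t : ℕ → V d) (m T : ℕ) :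
    rangeOn 0 (splice m s t) (Finset.Icc m (m + T)) =
      (Finset.range (T + 1)).image fun k => pos 0 s m + pos 0 t k := by
  ext y
  simp only [rangeOn, Finset.mem_image, Finset.mem_Icc, Finset.mem_range]
  constructor
  · rintro ⟨i, ⟨h1, h2⟩, rfl⟩
    obtain ⟨k, rfl⟩ := Nat.exists_eq_add_of_le h1
    exact ⟨k, by omega, by rw [pos_splice_add, ← pos_eq_add]⟩
  · rintro ⟨k, hk, rfl⟩
    exact ⟨m + k, ⟨by omega, by omega⟩, by rw [pos_splice_add, ← pos_eq_add]⟩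

lemma condExpN_chiC_le {d : ℕ} (hd : d ≠ 0) {N m T : ℕ} (hN : m + T ≤ N) (j : ℕ) (s : ℕ → V d)
    (hs : ∀ i, s i ∈ steps d) :
    condExpN d N m (fun s' => chiC (rangeOn 0 s' (Finset.Icc j m))
        (rangeOn 0 s' (Finset.Icc m (m + T)))) s ≤
      2 * ∑ x ∈ rangeOn 0 s (Finset.Icc 0 m),
        esc d (rangeOn 0 s (Finset.Icc 0 m)) x * GconvGT d T (x - pos 0 s m) := by
  obtain ⟨M, rfl⟩ := Nat.exists_eq_add_of_le (show m ≤ N by omega)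
  rw [condExpN_eq_expN_splice hd _ _ _ _ hs]
  simp only [rangeOn_splice_Icc, rangeOn_splice_Icc_add]
  by_cases h : Summable fun k => heat d k 0
  · set A := rangeOn 0 s (Finset.Icc j m) with hA
    have hsub : A ⊆ rangeOn 0 s (Finset.Icc 0 m) :=
      Finset.image_subset_image (Finset.Icc_subset_Icc_left (Nat.zero_le j))
    calc _ ≤ expN d M (fun t => 2 * ∑ k ∈ Finset.range (T + 1),
            eqPot A (pos 0 s m + pos 0 t k)) := by
          refine expN_mono M fun t => (chiC_le hd h _ _).trans ?_
          refine mul_le_mul_of_nonneg_left ?_ zero_le_two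
          exact Finset.sum_image_le_of_nonneg fun _ _ => eqPot_nonneg _ _
      _ = 2 * ∑ x ∈ A, esc d A x * GconvGT d T (x - pos 0 s m) := by
          rw [expN_const_mul, expN_sum, sum_esc_mul_GconvGT hd]
          congr 1
          refine Finset.sum_congr rfl fun k hk => ?_
          have := Finset.mem_range.1 hk
          exact expN_pos hd (fun y => eqPot A (pos 0 s m + y)) (by omega) 0
      _ ≤ _ := mul_le_mul_of_nonneg_left (sum_esc_mul_GconvGT_mono hd h T hsub _) zero_le_two
  · have hcap : ∀ A : Finset (V d), cap A = 0 := fun A =>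
      Finset.sum_eq_zero fun x hx => esc_eq_zero_of_not_summable hd h hx
    simp only [chiC, hcap, add_zero, sub_zero, expN_const_zero]
    exact mul_nonneg zero_le_two (Finset.sum_nonneg fun x _ =>
      mul_nonneg (esc_nonneg _ _ _) (GconvGT_nonneg _ _ _))

lemma sum_sum_le_sum_range {f : ℕ → ℝ} (hf : ∀ k, 0 ≤ f k) {n T : ℕ} (hT : 1 ≤ T) :
    ∑ j ∈ Finset.range T, ∑ l ∈ Finset.Icc 1 (n / T - 1), f (j + l * T) ≤
      ∑ k ∈ Finset.range (n + 1), f k := by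
  rw [← Finset.sum_product']
  have hinj : Set.InjOn (fun p : ℕ × ℕ => p.1 + p.2 * T)
      (Finset.range T ×ˢ Finset.Icc 1 (n / T - 1) : Finset (ℕ × ℕ)) := by
    rintro ⟨j, l⟩ h1 ⟨j', l'⟩ h2 h
    have hj : j < T := Finset.mem_range.1 (Finset.mem_product.1 (Finset.mem_coe.1 h1)).1
    have hj' : j' < T := Finset.mem_range.1 (Finset.mem_product.1 (Finset.mem_coe.1 h2)).1
    have hmod := congrArg (· % T) h
    have hdiv := congrArg (· / T) h
    simp only [Nat.add_mul_mod_self_right, Nat.mod_eq_of_lt hj, Nat.mod_eq_of_lt hj'] at hmod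
    simp only [Nat.add_mul_div_right _ _ hT, Nat.div_eq_of_lt hj, Nat.div_eq_of_lt hj',
      zero_add] at hdiv
    rw [hmod, hdiv]
  rw [← Finset.sum_image (f := f) hinj]
  refine Finset.sum_le_sum_of_subset_of_nonneg (fun k hk => ?_) fun k _ _ => hf k
  obtain ⟨⟨j, l⟩, hp, rfl⟩ := Finset.mem_image.1 hk
  simp only [Finset.mem_product, Finset.mem_range, Finset.mem_Icc] at hp ⊢
  obtain ⟨hj, hl, hl'⟩ := hp
  have h1 : (l + 1) * T ≤ n / T * T := Nat.mul_le_mul_right T (by omega)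
  have h2 := Nat.div_mul_le_self n T
  rw [add_mul] at h1
  omega

/-- The compensator is dominated by the corrector: `ξ_n^*(T) ≤ 2 ξ_n(T)`
along any admissible trajectory, for `d ≥ 5`, `n ≥ 2`, `1 ≤ T ≤ n`. -/
theorem xiStar_le_two_xi {d : ℕ} (hd : 5 ≤ d) (n T : ℕ) (hn : 2 ≤ n) (hT : 1 ≤ T)
    (hTn : T ≤ n) (s : ℕ → V d) (hs : ∀ i, s i ∈ steps d) :
    xiStar d n T s ≤ 2 * xi d n T s := by
  have hd0 : d ≠ 0 := by omega
  have hTpos : (0 : ℝ) < T := by exact_mod_cast hT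
  set F : ℕ → ℝ := fun k => ∑ x ∈ rangeOn 0 s (Finset.Icc 0 k),
    esc d (rangeOn 0 s (Finset.Icc 0 k)) x * GconvGT d T (x - pos 0 s k) with hF
  have hF0 : ∀ k, 0 ≤ F k := fun k => Finset.sum_nonneg fun x _ =>
    mul_nonneg (esc_nonneg _ _ _) (GconvGT_nonneg _ _ _)
  have hxi : xi d n T s = 1 / (T : ℝ) * ∑ k ∈ Finset.range (n + 1), F k := by
    simp only [xi, hF, Finset.mul_sum]
    exact Finset.sum_congr rfl fun k _ => Finset.sum_congr rfl fun x _ => by ring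
  rw [hxi, mul_left_comm, xiStar]
  refine mul_le_mul_of_nonneg_left ?_ (by positivity)
  refine le_trans ?_ (mul_le_mul_of_nonneg_left (sum_sum_le_sum_range hF0 hT) zero_le_two)
  rw [Finset.mul_sum]
  refine Finset.sum_le_sum fun j hj => ?_
  rw [Finset.mul_sum]
  refine Finset.sum_le_sum fun l hl => ?_
  rw [Finset.mem_range] at hj
  rw [Finset.mem_Icc] at hl
  have h1 : (l + 1) * T ≤ n / T * T := Nat.mul_le_mul_right T (by omega)
  have h2 := Nat.div_mul_le_self n T
  have h3 : j + (l + 1) * T = j + l * T + T := by ring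
  rw [h3]
  exact condExpN_chiC_le hd0 (by omega) j s hs

end SRW
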